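/- arXiv:1310.8182 — 6 statements merged into one kernel-verified Lean document; each statement's English description precedes it below -/
import Mathlib

section
/- Let n ≥ 1 and let S ⊆ ℕ^n. The language L_S over the alphabet Σ_n = {0,1}^n, defined by L_S = { w ∈ Σ_n^* : (w is empty or the last letter of w is not the all-zero letter) and (count_1(w), …, count_n(w)) ∈ S }, where count_j(w) denotes the number of letters of w whose j-th component is 1, is a regular (rational) language if and only if S is a finite union of sets of the form E_1 × ⋯ × E_n where each E_i ⊆ ℕ is ultimately periodic. -/
/-- `E ⊆ ℕ` is ultimately periodic. -/
def UltimatelyPeriodic (E : Set ℕ) : Prop :=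
  ∃ M p : ℕ, 1 ≤ p ∧ ∀ x : ℕ, M ≤ x → (x ∈ E ↔ x + p ∈ E)

/-- `S ⊆ ℕ^n` is a finite union of products of ultimately periodic sets. -/
def FinUnionUPProducts {n : ℕ} (S : Set (Fin n → ℕ)) : Prop :=
  ∃ (k : ℕ) (E : Fin k → Fin n → Set ℕ),
    (∀ t i, UltimatelyPeriodic (E t i)) ∧
    S = ⋃ t : Fin k, {x : Fin n → ℕ | ∀ i, x i ∈ E t i}

/-- The language `L_S` over the alphabet `Σ_n = {0,1}^n`: words whose last letter (if any)
is not the all-zero letter and whose tuple of `1`-counts lies in `S`. -/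
def LangOf (n : ℕ) (S : Set (Fin n → ℕ)) : Language (Fin n → Bool) :=
  {w : List (Fin n → Bool) |
    w.getLast? ≠ some (fun _ => false) ∧
    (fun j : Fin n => w.countP (fun a => a j)) ∈ S}

/-- An eventually periodic function on `ℕ` takes finitely many values. -/
theorem finite_range_of_eventually_periodic {α : Type*} (f : ℕ → α) (M p : ℕ) (hp : 1 ≤ p)
    (h : ∀ k, M ≤ k → f (k + p) = f k) : (Set.range f).Finite := by
  refine ((Set.finite_Iio (M + p)).image f).subset ?_
  rintro _ ⟨k, rfl⟩
  induction k using Nat.strong_induction_on with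
  | _ k ih =>
    by_cases hk : k < M + p
    · exact ⟨k, hk, rfl⟩
    · have := ih (k - p) (by omega)
      rwa [← h (k - p) (by omega), Nat.sub_add_cancel (by omega)] at this

theorem finite_range_of_factors {α β γ : Type*} (d : α → β) (f : α → γ)
    (hd : (Set.range d).Finite) (h : ∀ x y, d x = d y → f x = f y) : (Set.range f).Finite := by
  choose g hg using fun b : Set.range d => b.2
  have : Finite (Set.range d) := hd
  refine (Set.finite_range fun b => f (g b)).subset ?_
  rintro _ ⟨x, rfl⟩
  exact ⟨⟨d x, x, rfl⟩, h _ _ (hg ⟨d x, x, rfl⟩)⟩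

/-- Every tuple of counts is realized by a word without all-zero letters. -/
theorem exists_word_of_counts {n : ℕ} (v : Fin n → ℕ) :
    ∃ w : List (Fin n → Bool), (∀ a ∈ w, a ≠ fun _ => false) ∧
      (fun j => w.countP (fun a => a j)) = v := by
  refine ⟨(List.finRange n).flatMap fun j => List.replicate (v j) fun l => decide (l = j), ?_, ?_⟩
  · intro a ha h
    obtain ⟨j, -, hj⟩ := List.mem_flatMap.1 ha
    have := congrFun ((List.eq_of_mem_replicate hj).symm.trans h) j
    simp at this
  · funext i
    rw [List.countP_flatMap, ← List.ofFn_eq_map, List.sum_ofFn]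
    simp [List.countP_replicate]

theorem replicate_append_mem_LangOf {n : ℕ} (S : Set (Fin n → ℕ)) (i : Fin n) (m : ℕ)
    (v : Fin n → ℕ) (w : List (Fin n → Bool)) (hw : ∀ a ∈ w, a ≠ fun _ => false)
    (hv : (fun j => w.countP (fun a => a j)) = v) :
    List.replicate m (fun l => decide (l = i)) ++ w ∈ LangOf n S ↔
      Function.update v i (m + v i) ∈ S := by
  have hlast : (List.replicate m (fun l => decide (l = i)) ++ w).getLast? ≠
      some (fun _ => false) := by
    intro h
    rcases List.mem_append.1 (List.mem_of_getLast? h) with h | h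
    · have := congrFun (List.eq_of_mem_replicate h) i
      simp at this
    · exact hw _ h rfl
  have hcount : (fun j => (List.replicate m (fun l => decide (l = i)) ++ w).countP
      (fun a => a j)) = Function.update v i (m + v i) := by
    subst hv
    funext j
    by_cases hj : j = i
    · subst hj
      simp [List.countP_replicate]
    · simp [List.countP_replicate, hj]
  change (_ ∧ _) ↔ _
  rw [hcount]
  exact and_iff_right hlast

/-- The section of `S` at the value `k` of the coordinate `i`. -/
def coordSection {n : ℕ} (S : Set (Fin n → ℕ)) (i : Fin n) (k : ℕ) : Set (Fin n → ℕ) :=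
  {x | Function.update x i k ∈ S}

theorem coordSection_eventually_periodic {n : ℕ} {S : Set (Fin n → ℕ)}
    (h : (LangOf n S).IsRegular) (i : Fin n) :
    ∃ M p : ℕ, 1 ≤ p ∧ ∀ k, M ≤ k → coordSection S i (k + p) = coordSection S i k := by
  have hfin := h.finite_range_leftQuotient
  obtain ⟨a, b, hab, heq⟩ : ∃ a b : ℕ, a < b ∧
      (LangOf n S).leftQuotient (List.replicate a fun l => decide (l = i)) =
      (LangOf n S).leftQuotient (List.replicate b fun l => decide (l = i)) :=
    Set.Finite.exists_lt_map_eq_of_forall_mem (fun m => Set.mem_range_self _) hfin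
  refine ⟨a, b - a, by omega, fun k hk => Set.ext fun x => ?_⟩
  obtain ⟨w, hw, hv⟩ := exists_word_of_counts (Function.update x i (k - a))
  have key := Set.ext_iff.1 heq w
  change _ ++ _ ∈ LangOf n S ↔ _ ++ _ ∈ LangOf n S at key
  rw [replicate_append_mem_LangOf S i a _ w hw hv, replicate_append_mem_LangOf S i b _ w hw hv]
    at key
  simp only [Function.update_self, Function.update_idem] at key
  rw [show a + (k - a) = k by omega, show b + (k - a) = k + (b - a) by omega] at key
  exact key.symm

theorem mem_of_coordSection_eq {n : ℕ} {S : Set (Fin n → ℕ)} {x y : Fin n → ℕ}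
    (h : ∀ i, coordSection S i (x i) = coordSection S i (y i)) (hx : x ∈ S) : y ∈ S := by
  have key : ∀ s : Finset (Fin n), s.piecewise y x ∈ S := by
    intro s
    induction s using Finset.induction_on with
    | empty => simpa using hx
    | insert i s hi ih =>
      rw [Finset.piecewise_insert]
      change s.piecewise y x ∈ coordSection S i (y i)
      rw [← h i]
      change Function.update _ _ _ ∈ S
      rwa [← Finset.piecewise_eq_of_notMem s y x hi, Function.update_eq_self]
  simpa using key Finset.univ

theorem FinUnionUPProducts.of_isRegular {n : ℕ} {S : Set (Fin n → ℕ)}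
    (h : (LangOf n S).IsRegular) : FinUnionUPProducts S := by
  choose M p hp hper using coordSection_eventually_periodic h
  have hfin (i : Fin n) : Finite (Set.range (coordSection S i)) :=
    finite_range_of_eventually_periodic _ (M i) (p i) (hp i) (hper i)
  let I := {c : ∀ i : Fin n, Set.range (coordSection S i) //
    ∃ x ∈ S, ∀ i, coordSection S i (x i) = c i}
  obtain ⟨k, ⟨e⟩⟩ := Finite.exists_equiv_fin I
  refine ⟨k, fun t i => {m | coordSection S i m = (e.symm t).1 i}, fun t i =>
    ⟨M i, p i, hp i, fun m hm => ?_⟩, Set.ext fun x => ?_⟩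
  · simp [hper i m hm]
  · simp only [Set.mem_iUnion, Set.mem_ofPred_eq]
    constructor
    · intro hx
      refine ⟨e ⟨fun i => ⟨_, x i, rfl⟩, x, hx, fun _ => rfl⟩, fun i => ?_⟩
      rw [e.symm_apply_apply]
    · rintro ⟨t, ht⟩
      obtain ⟨y, hy, hyt⟩ := (e.symm t).2
      exact mem_of_coordSection_eq (fun i => (hyt i).trans (ht i).symm) hy

theorem UltimatelyPeriodic.finite_range_translates {E : Set ℕ} (hE : UltimatelyPeriodic E) :
    (Set.range fun k : ℕ => {l | k + l ∈ E}).Finite := by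
  obtain ⟨M, p, hp, h⟩ := hE
  refine finite_range_of_eventually_periodic _ M p hp fun k hk => Set.ext fun l => ?_
  simp only [Set.mem_ofPred_eq]
  rw [h (k + l) (by omega), add_right_comm]

theorem FinUnionUPProducts.isRegular {n : ℕ} {S : Set (Fin n → ℕ)}
    (h : FinUnionUPProducts S) : (LangOf n S).IsRegular := by
  obtain ⟨K, E, hE, rfl⟩ := h
  let d : List (Fin n → Bool) → (Fin n → Fin K → Set ℕ) × Option (Fin n → Bool) := fun w =>
    (fun j t => {l | w.countP (fun a => a j) + l ∈ E t j}, w.getLast?)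
  refine .of_finite_range_leftQuotient (finite_range_of_factors d _ ?_ fun x y hxy => ?_)
  · refine ((Set.Finite.pi' fun j => Set.Finite.pi' fun t =>
      (hE t j).finite_range_translates).prod (Set.finite_univ (α := Option (Fin n → Bool)))).subset
      ?_
    rintro _ ⟨w, rfl⟩
    exact ⟨fun j t => ⟨_, rfl⟩, trivial⟩
  · obtain ⟨hcount, hlast⟩ := Prod.ext_iff.1 hxy
    have hmem (j : Fin n) (t : Fin K) (l : ℕ) :
        x.countP (fun a => a j) + l ∈ E t j ↔ y.countP (fun a => a j) + l ∈ E t j :=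
      Set.ext_iff.1 (congrFun (congrFun hcount j) t) l
    have hlast : x.getLast? = y.getLast? := hlast
    refine Set.ext fun z => ?_
    change (_ ∧ _) ↔ (_ ∧ _)
    simp only [List.getLast?_append, hlast, List.countP_append, Set.mem_iUnion, Set.mem_ofPred_eq,
      hmem]

theorem stmt_0 (n : ℕ) (hn : 1 ≤ n) (S : Set (Fin n → ℕ)) :
    (LangOf n S).IsRegular ↔ FinUnionUPProducts S := by
  exact ⟨FinUnionUPProducts.of_isRegular, FinUnionUPProducts.isRegular⟩
end

section
/- Let n ≥ 1 and let S ⊆ ℕ^n. Then S is a finite union of sets of the form E_1 × ⋯ × E_n with each E_i ⊆ ℕ ultimately periodic, if and only if the following two conditions hold: (a) every section S_{i,C} ⊆ ℕ^{n−1} (for i ∈ [1,n] and C ∈ ℕ) is a finite union of sets of the form E_1 × ⋯ × E_{n−1} with each E_j ⊆ ℕ ultimately periodic (for n = 1 the sections are subsets of the one-point set ℕ^0 and this condition is vacuous), and (b) S is strongly ultimately periodic (STRUP). -/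
/-- `S ⊆ ℕ^n` is `(m,p)`-strongly ultimately periodic. -/
def MuSTRUP {n : ℕ} (S : Set (Fin n → ℕ)) (m : ℕ) (p : Fin n → ℕ) : Prop :=
  (∀ i, 1 ≤ p i) ∧
    ∀ x : Fin n → ℕ, (∀ i, m ≤ x i) → ∀ j : Fin n,
      (x ∈ S ↔ Function.update x j (x j + p j) ∈ S)

/-- `S ⊆ ℕ^n` is strongly ultimately periodic. -/
def STRUP {n : ℕ} (S : Set (Fin n → ℕ)) : Prop :=
  ∃ (m : ℕ) (p : Fin n → ℕ), MuSTRUP S m p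

/-- Sections of `S ⊆ ℕ^{n+1}`: fix the `i`-th coordinate to `C`. -/
def Section {n : ℕ} (S : Set (Fin (n + 1) → ℕ)) (i : Fin (n + 1)) (C : ℕ) :
    Set (Fin n → ℕ) :=
  {y : Fin n → ℕ | i.insertNth C y ∈ S}

theorem UltimatelyPeriodic.singleton (C : ℕ) : UltimatelyPeriodic {C} :=
  ⟨C + 1, 1, le_rfl, fun x hx => by simp only [Set.mem_singleton_iff]; omega⟩

theorem UltimatelyPeriodic.progression (m r : ℕ) {p : ℕ} (hp : 1 ≤ p) :
    UltimatelyPeriodic {y | m ≤ y ∧ (y - m) % p = r} := by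
  refine ⟨m, p, hp, fun x hx => ?_⟩
  have h : x + p - m = x - m + p := by omega
  simp only [Set.mem_ofPred_eq, h, Nat.add_mod_right]
  omega

theorem mem_iff_add_mul_mem {E : Set ℕ} {M p : ℕ}
    (h : ∀ x, M ≤ x → (x ∈ E ↔ x + p ∈ E)) (k : ℕ) {x : ℕ} (hx : M ≤ x) :
    x ∈ E ↔ x + k * p ∈ E := by
  induction k with
  | zero => simp
  | succ k ih => rw [ih, h _ (by omega), add_mul, one_mul, add_assoc]

theorem exists_common_period {ι : Type*} [Fintype ι] {E : ι → Set ℕ}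
    (h : ∀ i, UltimatelyPeriodic (E i)) :
    ∃ M p : ℕ, 1 ≤ p ∧ ∀ i x, M ≤ x → (x ∈ E i ↔ x + p ∈ E i) := by
  choose M p hp h using h
  refine ⟨Finset.univ.sup M, ∏ i, p i,
    Nat.succ_le_of_lt (Finset.prod_pos fun i _ => hp i), fun i x hx => ?_⟩
  obtain ⟨c, hc⟩ := Finset.dvd_prod_of_mem p (Finset.mem_univ i)
  rw [hc, mul_comm]
  exact mem_iff_add_mul_mem (h i) c ((Finset.le_sup (Finset.mem_univ i)).trans hx)

namespace FinUnionUPProducts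

variable {n : ℕ}

theorem of_finite {ι : Type*} [Finite ι] {E : ι → Fin n → Set ℕ}
    (h : ∀ t i, UltimatelyPeriodic (E t i)) :
    FinUnionUPProducts (⋃ t, {x : Fin n → ℕ | ∀ i, x i ∈ E t i}) := by
  obtain ⟨k, ⟨e⟩⟩ := Finite.exists_equiv_fin ι
  refine ⟨k, fun t => E (e.symm t), fun t => h _, ?_⟩
  exact (e.symm.surjective.iUnion_comp fun t => {x : Fin n → ℕ | ∀ i, x i ∈ E t i}).symm

protected theorem iUnion {ι : Type*} [Finite ι] {S : ι → Set (Fin n → ℕ)}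
    (h : ∀ t, FinUnionUPProducts (S t)) : FinUnionUPProducts (⋃ t, S t) := by
  choose k E hE hS using h
  have := of_finite (ι := Σ t, Fin (k t)) (E := fun t => E t.1 t.2) fun t => hE _ _
  rw [Set.iUnion_sigma] at this
  simpa only [← hS] using this

protected theorem union {S T : Set (Fin n → ℕ)} (hS : FinUnionUPProducts S)
    (hT : FinUnionUPProducts T) : FinUnionUPProducts (S ∪ T) := by
  rw [Set.union_eq_iUnion]
  exact FinUnionUPProducts.iUnion fun b => by cases b <;> assumption

theorem section_mem {S : Set (Fin (n + 1) → ℕ)} (hS : FinUnionUPProducts S)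
    (i : Fin (n + 1)) (C : ℕ) : FinUnionUPProducts (Section S i C) := by
  obtain ⟨k, E, hE, rfl⟩ := hS
  have h : Section (⋃ t, {x : Fin (n + 1) → ℕ | ∀ i, x i ∈ E t i}) i C =
      ⋃ t : {t // C ∈ E t i}, {y : Fin n → ℕ | ∀ j, y j ∈ E t (i.succAbove j)} := by
    ext y
    simp [Section, Fin.forall_iff_succAbove i]
  rw [h]
  exact of_finite fun t j => hE _ _

theorem strup {S : Set (Fin n → ℕ)} (hS : FinUnionUPProducts S) : STRUP S := by
  obtain ⟨k, E, hE, rfl⟩ := hS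
  obtain ⟨m, p, hp, h⟩ :=
    exists_common_period (ι := Fin k × Fin n) (E := fun q => E q.1 q.2) fun q => hE _ _
  refine ⟨m, fun _ => p, fun _ => hp, fun x hx j => ?_⟩
  simp only [Set.mem_iUnion, Set.mem_ofPred_eq]
  refine exists_congr fun t => forall_congr' fun i => ?_
  obtain rfl | hij := eq_or_ne i j
  · simpa using h (t, i) (x i) (hx i)
  · simp [hij]

theorem insertNth {T : Set (Fin n → ℕ)} (hT : FinUnionUPProducts T)
    (i : Fin (n + 1)) (C : ℕ) :
    FinUnionUPProducts {x : Fin (n + 1) → ℕ | x i = C ∧ i.removeNth x ∈ T} := by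
  obtain ⟨k, E, hE, rfl⟩ := hT
  have h : {x : Fin (n + 1) → ℕ | x i = C ∧
        i.removeNth x ∈ ⋃ t, {y : Fin n → ℕ | ∀ j, y j ∈ E t j}} =
      ⋃ t, {x | ∀ j, x j ∈ i.insertNth (α := fun _ => Set ℕ) {C} (E t) j} := by
    ext x
    simp [Fin.forall_iff_succAbove i, Fin.removeNth]
  rw [h]
  refine of_finite fun t => (Fin.forall_iff_succAbove i).2 ⟨?_, fun j => ?_⟩
  · simpa using UltimatelyPeriodic.singleton C
  · simpa using hE t j

end FinUnionUPProducts

namespace MuSTRUP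

variable {n m : ℕ} {S : Set (Fin n → ℕ)} {p : Fin n → ℕ}

theorem mem_iff_update (h : MuSTRUP S m p) {x : Fin n → ℕ} (hx : ∀ i, m ≤ x i)
    (j : Fin n) (k : ℕ) : x ∈ S ↔ Function.update x j (x j + k * p j) ∈ S := by
  have := mem_iff_add_mul_mem (E := {a | Function.update x j a ∈ S}) (M := m) (p := p j)
    (fun a ha => by
      have hu : ∀ i, m ≤ Function.update x j a i := fun i => by
        obtain rfl | hij := eq_or_ne i j <;> simp [*]
      simpa using h.2 _ hu j) k (hx j)
  simpa using this

theorem mem_iff_add_mul (h : MuSTRUP S m p) {x : Fin n → ℕ} (hx : ∀ i, m ≤ x i)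
    (k : Fin n → ℕ) : x ∈ S ↔ (fun i => x i + k i * p i) ∈ S := by
  suffices H : ∀ s : Finset (Fin n),
      x ∈ S ↔ (fun i => if i ∈ s then x i + k i * p i else x i) ∈ S by
    simpa using H Finset.univ
  intro s
  induction s using Finset.induction_on with
  | empty => simp
  | insert j s hj ih =>
    rw [ih, h.mem_iff_update (fun i => ?_) j (k j)]
    · refine iff_of_eq (congrArg (· ∈ S) (funext fun i => ?_))
      obtain rfl | hij := eq_or_ne i j <;> simp [*]
    · have := hx i
      split_ifs <;> omega

theorem finUnionUPProducts_inter (h : MuSTRUP S m p) :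
    FinUnionUPProducts {x | x ∈ S ∧ ∀ i, m ≤ x i} := by
  have hU : {x | x ∈ S ∧ ∀ i, m ≤ x i} =
      ⋃ r : {r : ∀ i, Fin (p i) // (fun i => m + (r i : ℕ)) ∈ S},
        {x : Fin n → ℕ | ∀ i, x i ∈ {y | m ≤ y ∧ (y - m) % p i = r.1 i}} := by
    ext x
    simp only [Set.mem_ofPred_eq, Set.mem_iUnion]
    have key (hx : ∀ i, m ≤ x i) : (fun i => m + (x i - m) % p i) ∈ S ↔ x ∈ S := by
      rw [h.mem_iff_add_mul (fun i => Nat.le_add_right _ _) fun i => (x i - m) / p i]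
      refine iff_of_eq (congrArg (· ∈ S) (funext fun i => ?_))
      have := Nat.mod_add_div' (x i - m) (p i)
      have := hx i
      omega
    constructor
    · rintro ⟨hxS, hx⟩
      exact ⟨⟨fun i => ⟨(x i - m) % p i, Nat.mod_lt _ (h.1 i)⟩, (key hx).2 hxS⟩,
        fun i => ⟨hx i, rfl⟩⟩
    · rintro ⟨⟨r, hr⟩, hx⟩
      refine ⟨(key fun i => (hx i).1).1 ?_, fun i => (hx i).1⟩
      simpa only [(hx _).2] using hr
  rw [hU]
  exact FinUnionUPProducts.of_finite fun r i => UltimatelyPeriodic.progression _ _ (h.1 i)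

end MuSTRUP

theorem stmt_1 (n : ℕ) (S : Set (Fin (n + 1) → ℕ)) :
    FinUnionUPProducts S ↔
      ((∀ (i : Fin (n + 1)) (C : ℕ), FinUnionUPProducts (Section S i C)) ∧ STRUP S) := by
  refine ⟨fun h => ⟨h.section_mem, h.strup⟩, ?_⟩
  rintro ⟨hsec, m, p, h⟩
  have hU : S = (⋃ q : Fin (n + 1) × Fin m,
      {x : Fin (n + 1) → ℕ | x q.1 = q.2 ∧ q.1.removeNth x ∈ Section S q.1 q.2}) ∪
        {x | x ∈ S ∧ ∀ i, m ≤ x i} := by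
    have hmem (x : Fin (n + 1) → ℕ) (i : Fin (n + 1)) :
        i.removeNth x ∈ Section S i (x i) ↔ x ∈ S := by
      simp [Section]
    ext x
    simp only [Set.mem_union, Set.mem_iUnion, Set.mem_ofPred_eq]
    constructor
    · intro hx
      by_cases hm : ∀ i, m ≤ x i
      · exact Or.inr ⟨hx, hm⟩
      · push Not at hm
        obtain ⟨i, hi⟩ := hm
        exact Or.inl ⟨(i, ⟨x i, hi⟩), rfl, (hmem x i).2 hx⟩
    · rintro (⟨q, hq, hx⟩ | ⟨hx, -⟩)
      · rw [← hq] at hx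
        exact (hmem x q.1).1 hx
      · exact hx
  rw [hU]
  refine FinUnionUPProducts.union (.iUnion fun q => ?_) h.finUnionUPProducts_inter
  exact (hsec q.1 q.2).insertNth q.1 q.2
end

section
/- Let n ≥ 1, let a_1, …, a_n be n pairwise distinct letters of a finite alphabet, and let L be a regular (rational) language every word of which has the form a_1^{x_1} a_2^{x_2} ⋯ a_n^{x_n} for some (x_1,…,x_n) ∈ ℕ^n. Then the set {(x_1,…,x_n) ∈ ℕ^n : a_1^{x_1} a_2^{x_2} ⋯ a_n^{x_n} ∈ L} is a finite union of sets of the form E_1 × ⋯ × E_n where each E_i ⊆ ℕ is ultimately periodic. -/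
/-- The word `a_1^{x_1} a_2^{x_2} ⋯ a_n^{x_n}`. -/
def blockWord {α : Type} {n : ℕ} (a : Fin n → α) (x : Fin n → ℕ) : List α :=
  (List.ofFn fun i => List.replicate (x i) (a i)).flatten

/-- The iterates of a self-map of a finite type are ultimately periodic in the exponent. -/
theorem ultimatelyPeriodic_iterate_eq {τ : Type*} [Finite τ] (f g : τ → τ) :
    UltimatelyPeriodic {x : ℕ | f^[x] = g} := by
  have key : ∃ m k : ℕ, m < k ∧ f^[m] = f^[k] := by
    obtain ⟨m, k, hne, h⟩ := Finite.exists_ne_map_eq_of_infinite (fun x : ℕ => f^[x])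
    rcases lt_or_gt_of_ne hne with hlt | hlt
    · exact ⟨m, k, hlt, h⟩
    · exact ⟨k, m, hlt, h.symm⟩
  obtain ⟨m, k, hlt, h⟩ := key
  refine ⟨m, k - m, by omega, fun x hx => ?_⟩
  have hper : f^[x + (k - m)] = f^[x] := by
    rw [show x + (k - m) = (x - m) + k by omega, Function.iterate_add, ← h,
      ← Function.iterate_add, Nat.sub_add_cancel hx]
  simp only [Set.mem_ofPred_eq, hper]

/-- A set of tuples that only depends on the coordinatewise images under maps to a finite type
with ultimately periodic fibres is a finite union of products of ultimately periodic sets. -/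
theorem finUnionUPProducts_of_finite_coloring {n : ℕ} {τ : Type*} [Finite τ]
    (φ : Fin n → ℕ → τ) (hφ : ∀ i g, UltimatelyPeriodic {x : ℕ | φ i x = g})
    (S : Set (Fin n → ℕ))
    (hS : ∀ x y, (∀ i, φ i (x i) = φ i (y i)) → x ∈ S → y ∈ S) :
    FinUnionUPProducts S := by
  obtain ⟨k, ⟨e⟩⟩ := Finite.exists_equiv_fin
    {g : Fin n → τ // ∃ x ∈ S, ∀ i, φ i (x i) = g i}
  refine ⟨k, fun t i => {x | φ i x = (e.symm t).1 i}, fun t i => hφ i _, ?_⟩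
  ext y
  simp only [Set.mem_iUnion, Set.mem_ofPred_eq]
  constructor
  · intro hy
    exact ⟨e ⟨fun i => φ i (y i), y, hy, fun _ => rfl⟩, fun i => by simp⟩
  · rintro ⟨t, ht⟩
    obtain ⟨x, hx, hxg⟩ := (e.symm t).2
    exact hS x y (fun i => (hxg i).trans (ht i).symm) hx

theorem DFA.evalFrom_replicate {α σ : Type*} (M : DFA α σ) (a : α) (m : ℕ) (s : σ) :
    M.evalFrom s (List.replicate m a) = (fun q => M.step q a)^[m] s := by
  induction m generalizing s with
  | zero => rfl
  | succ m ih => rw [List.replicate_succ, DFA.evalFrom_cons, ih, Function.iterate_succ_apply]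

theorem DFA.evalFrom_flatten_ofFn_congr {α σ : Type*} (M : DFA α σ) {n : ℕ}
    (u v : Fin n → List α) (h : ∀ i s, M.evalFrom s (u i) = M.evalFrom s (v i)) (s : σ) :
    M.evalFrom s (List.ofFn u).flatten = M.evalFrom s (List.ofFn v).flatten := by
  induction n generalizing s with
  | zero => simp
  | succ n ih =>
    simp only [List.ofFn_succ, List.flatten_cons, DFA.evalFrom_of_append, h 0]
    exact ih _ _ (fun i => h i.succ) _

theorem stmt_2 {α : Type} [Fintype α] (n : ℕ) (hn : 1 ≤ n)
    (a : Fin n → α) (ha : Function.Injective a)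
    (L : Language α) (hreg : L.IsRegular)
    (hform : ∀ w ∈ L, ∃ x : Fin n → ℕ, w = blockWord a x) :
    FinUnionUPProducts {x : Fin n → ℕ | blockWord a x ∈ L} := by
  obtain ⟨σ, _, M, rfl⟩ := hreg
  refine finUnionUPProducts_of_finite_coloring (fun i m => (fun q => M.step q (a i))^[m])
    (fun i g => ultimatelyPeriodic_iterate_eq _ g) _ fun x y hxy hx => ?_
  have heval : M.eval (blockWord a x) = M.eval (blockWord a y) :=
    M.evalFrom_flatten_ofFn_congr _ _
      (fun i s => by simpa only [DFA.evalFrom_replicate] using congrFun (hxy i) s) _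
  simpa only [Set.mem_ofPred_eq, DFA.mem_accepts, heval] using hx
end

section
/- Let n ≥ 1 and let S ⊆ ℕ^n be a set which is not strongly ultimately periodic (not STRUP). Then for all finite sets X, Y ⊆ ℕ, the cardinalities |X| and |Y| are equal if and only if the following condition FF(X,Y) holds: for all finite sets Z_1, …, Z_n ⊆ ℕ and every i ∈ [1,n], if Z_i ∩ (X ∪ Y) = ∅ then (|Z_1|, …, |Z_{i−1}|, |Z_i ∪ X|, |Z_{i+1}|, …, |Z_n|) ∈ S iff (|Z_1|, …, |Z_{i−1}|, |Z_i ∪ Y|, |Z_{i+1}|, …, |Z_n|) ∈ S. -/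
/-- Membership invariance under replacing `a` by `b > a` in each coordinate yields strong ultimate
periodicity with threshold `a` and period `b - a` in every coordinate. -/
theorem STRUP.of_update_add_iff {n : ℕ} {S : Set (Fin n → ℕ)} {a b : ℕ} (hab : a < b)
    (h : ∀ (z : Fin n → ℕ) (i : Fin n),
      Function.update z i (z i + a) ∈ S ↔ Function.update z i (z i + b) ∈ S) : STRUP S := by
  refine ⟨a, fun _ => b - a, fun _ => Nat.sub_pos_of_lt hab, fun x hx j => ?_⟩
  have key := h (Function.update x j (x j - a)) j
  have hb : x j - a + b = x j + (b - a) := by have := hx j; omega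
  simpa only [Function.update_idem, Function.update_self, Nat.sub_add_cancel (hx j),
    Function.update_eq_self, hb] using key

theorem Finset.exists_card_eq_and_disjoint {α : Type*} [Infinite α] (s : Finset α) (k : ℕ) :
    ∃ t : Finset α, t.card = k ∧ Disjoint t s := by
  obtain ⟨t, ht, hk⟩ := s.finite_toSet.infinite_compl.exists_subset_card_eq k
  exact ⟨t, hk, Finset.disjoint_left.2 fun _ hx => ht hx⟩

theorem stmt_6 (n : ℕ) (hn : 1 ≤ n) (S : Set (Fin n → ℕ)) (hS : ¬ STRUP S)
    (X Y : Finset ℕ) :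
    X.card = Y.card ↔
      ∀ (Z : Fin n → Finset ℕ) (i : Fin n), Disjoint (Z i) (X ∪ Y) →
        (Function.update (fun j => (Z j).card) i ((Z i ∪ X).card) ∈ S ↔
         Function.update (fun j => (Z j).card) i ((Z i ∪ Y).card) ∈ S) := by
  have hcard (Z : Finset ℕ) (hZ : Disjoint Z (X ∪ Y)) :
      (Z ∪ X).card = Z.card + X.card ∧ (Z ∪ Y).card = Z.card + Y.card :=
    ⟨Finset.card_union_of_disjoint (hZ.mono_right Finset.subset_union_left),
      Finset.card_union_of_disjoint (hZ.mono_right Finset.subset_union_right)⟩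
  constructor
  · intro h Z i hZ
    rw [(hcard _ hZ).1, (hcard _ hZ).2, h]
  · intro h
    have key (z : Fin n → ℕ) (i : Fin n) :
        Function.update z i (z i + X.card) ∈ S ↔ Function.update z i (z i + Y.card) ∈ S := by
      choose Z hZc hZd using fun j => (X ∪ Y).exists_card_eq_and_disjoint (z j)
      simpa only [(hcard _ (hZd i)).1, (hcard _ (hZd i)).2, hZc] using h Z i (hZd i)
    rcases lt_trichotomy X.card Y.card with hlt | heq | hgt
    · exact (hS (.of_update_add_iff hlt key)).elim
    · exact heq
    · exact (hS (.of_update_add_iff hgt fun z i => (key z i).symm)).elim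
end

section
/- Let n ≥ 1, let S ⊆ ℕ^n be arbitrary, and let q ≥ 1. For finite sets X, Y ⊆ [0, q), define FF_q(X,Y) to hold if for all sets Z_1, …, Z_n ⊆ [0, q) and every i ∈ [1,n], if Z_i ∩ (X ∪ Y) = ∅ then (|Z_1|, …, |Z_{i−1}|, |Z_i ∪ X|, |Z_{i+1}|, …, |Z_n|) ∈ S iff (|Z_1|, …, |Z_{i−1}|, |Z_i ∪ Y|, |Z_{i+1}|, …, |Z_n|) ∈ S; and define φ_q(X,Y) to hold if FF_q(X,Y) holds, there is no proper subset X' ⊊ X with FF_q(X',Y), and there is no proper subset Y' ⊊ Y with FF_q(X,Y'). Then for all X, Y ⊆ [0, q), if φ_q(X,Y) holds then |X| = |Y|. -/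
/-- The relation `FF_q(X,Y)` relative to `S ⊆ ℕ^n`, over the domain `[0,q)`. -/
def FFq (n q : ℕ) (S : Set (Fin n → ℕ)) (X Y : Finset ℕ) : Prop :=
  ∀ Z : Fin n → Finset ℕ, (∀ i, Z i ⊆ Finset.range q) →
    ∀ i : Fin n, Disjoint (Z i) (X ∪ Y) →
      (Function.update (fun j => (Z j).card) i ((Z i ∪ X).card) ∈ S ↔
       Function.update (fun j => (Z j).card) i ((Z i ∪ Y).card) ∈ S)

/-- The relation `φ_q(X,Y)`: `FF_q(X,Y)` holds and is minimal in both arguments. -/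
def Phiq (n q : ℕ) (S : Set (Fin n → ℕ)) (X Y : Finset ℕ) : Prop :=
  FFq n q S X Y ∧
    (¬ ∃ X' : Finset ℕ, X' ⊂ X ∧ FFq n q S X' Y) ∧
    (¬ ∃ Y' : Finset ℕ, Y' ⊂ Y ∧ FFq n q S X Y')

theorem FFq_of_card_eq {n q : ℕ} {S : Set (Fin n → ℕ)} {X Y : Finset ℕ}
    (h : X.card = Y.card) : FFq n q S X Y := by
  intro Z _ i hi
  rw [Finset.disjoint_union_right] at hi
  rw [Finset.card_union_of_disjoint hi.1, Finset.card_union_of_disjoint hi.2, h]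

theorem exists_ssubset_card_eq {s : Finset ℕ} {k : ℕ} (h : k < s.card) :
    ∃ t, t ⊂ s ∧ t.card = k := by
  obtain ⟨t, hts, ht⟩ := Finset.exists_subset_card_eq h.le
  refine ⟨t, hts.ssubset_of_ne ?_, ht⟩
  rintro rfl
  exact h.ne' ht

theorem stmt_7 (n : ℕ) (hn : 1 ≤ n) (S : Set (Fin n → ℕ)) (q : ℕ) (hq : 1 ≤ q)
    (X Y : Finset ℕ) (hX : X ⊆ Finset.range q) (hY : Y ⊆ Finset.range q)
    (h : Phiq n q S X Y) :
    X.card = Y.card := by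
  obtain ⟨-, hXmin, hYmin⟩ := h
  rcases lt_trichotomy X.card Y.card with hlt | heq | hgt
  · obtain ⟨Y', hss, hcard⟩ := exists_ssubset_card_eq hlt
    exact absurd ⟨Y', hss, FFq_of_card_eq hcard.symm⟩ hYmin
  · exact heq
  · obtain ⟨X', hss, hcard⟩ := exists_ssubset_card_eq hgt
    exact absurd ⟨X', hss, FFq_of_card_eq hcard⟩ hXmin
end

section
/- Let p, q ∈ ℕ with 2^{p+2} ≤ q < 2^{p+3}, and let X, Y ⊆ [0, q) be sets with |X| < |Y| ≤ 2^p. Then there exists a set Z ⊆ [0, q) with Z ∩ (X ∪ Y) = ∅ such that |Y ∪ Z| is a power of 2 and |X ∪ Z| is not a power of 2. -/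
theorem stmt_13 (p q : ℕ) (h1 : 2 ^ (p + 2) ≤ q) (h2 : q < 2 ^ (p + 3))
    (X Y : Finset ℕ) (hX : X ⊆ Finset.range q) (hY : Y ⊆ Finset.range q)
    (hXY : X.card < Y.card) (hYk : Y.card ≤ 2 ^ p) :
    ∃ Z : Finset ℕ, Z ⊆ Finset.range q ∧ Disjoint Z (X ∪ Y) ∧
      (∃ m : ℕ, (Y ∪ Z).card = 2 ^ m) ∧ ¬ ∃ m : ℕ, (X ∪ Z).card = 2 ^ m := by
  by_cases hc : X.card = 0 ∧ Y.card = 2 ^ p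
  · refine ⟨∅, by simp, by simp, ⟨p, by simpa using hc.2⟩, ?_⟩
    rintro ⟨m, hm⟩
    have := Nat.two_pow_pos m
    rw [Finset.union_empty, hc.1] at hm
    omega
  · have e1 : 2 ^ (p + 1) = 2 * 2 ^ p := by ring
    have e2 : 2 ^ (p + 2) = 4 * 2 ^ p := by ring
    have hU := Finset.card_union_le X Y
    have hcompl : 2 ^ (p + 1) - Y.card ≤ (Finset.range q \ (X ∪ Y)).card := by
      rw [Finset.card_sdiff_of_subset (Finset.union_subset hX hY), Finset.card_range]
      omega
    obtain ⟨Z, hZ, hZcard⟩ := Finset.exists_subset_card_eq hcompl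
    have hd : Disjoint Z (X ∪ Y) := Finset.disjoint_of_subset_left hZ Finset.sdiff_disjoint
    obtain ⟨hdX, hdY⟩ := Finset.disjoint_union_right.mp hd
    refine ⟨Z, hZ.trans Finset.sdiff_subset, hd, ⟨p + 1, ?_⟩, ?_⟩
    · rw [Finset.card_union_of_disjoint hdY.symm]
      omega
    · rintro ⟨m, hm⟩
      rw [Finset.card_union_of_disjoint hdX.symm] at hm
      have hlo : p < m := (Nat.pow_lt_pow_iff_right one_lt_two).mp (by omega : 2 ^ p < 2 ^ m)
      have hhi : m < p + 1 :=
        (Nat.pow_lt_pow_iff_right one_lt_two).mp (by omega : 2 ^ m < 2 ^ (p + 1))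
      omega
end
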